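/- arXiv:2310.04283 — 2 statements merged into one kernel-verified Lean document; each statement's English description precedes it below -/
import Mathlib

section
/- Let x₀ be sampled uniformly from the unit sphere in ℝ^d (d ≥ 8) and let u be any fixed unit vector. Then P(|x₀ᵀ u| ≥ 1/√(1 + 2d³)) ≥ 1 − 2/(3d). -/
open MeasureTheory
open scoped ENNReal RealInnerProductSpace

lemma aux_gauss_interval (r : ℝ) :
    ProbabilityTheory.gaussianReal 0 1 {t : ℝ | |t| ≤ r}
      ≤ ENNReal.ofReal (2 * r / Real.sqrt (2 * Real.pi)) := by
  have hset : {t : ℝ | |t| ≤ r} = Set.Icc (-r) r := by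
    ext t; simp [abs_le]
  rw [hset, ProbabilityTheory.gaussianReal_apply 0 one_ne_zero]
  calc ∫⁻ x in Set.Icc (-r) r, ProbabilityTheory.gaussianPDF 0 1 x
      ≤ ∫⁻ x in Set.Icc (-r) r, ENNReal.ofReal (Real.sqrt (2 * Real.pi))⁻¹ := by
        refine lintegral_mono fun x => ?_
        unfold ProbabilityTheory.gaussianPDF
        refine ENNReal.ofReal_le_ofReal ?_
        rw [ProbabilityTheory.gaussianPDFReal_def]
        have h1 : Real.exp (-(x - 0) ^ 2 / (2 * ((1 : NNReal) : ℝ))) ≤ 1 := by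
          rw [Real.exp_le_one_iff]
          have := sq_nonneg (x - 0)
          simp only [NNReal.coe_one]
          linarith
        have h2 : 0 ≤ (Real.sqrt (2 * Real.pi))⁻¹ := by positivity
        simpa using mul_le_mul_of_nonneg_left h1 h2
    _ = ENNReal.ofReal (2 * r / Real.sqrt (2 * Real.pi)) := by
        rw [setLIntegral_const, Real.volume_Icc, ← ENNReal.ofReal_mul (by positivity)]
        congr 1; ring

lemma aux_sq_integrable :
    Integrable (fun x : ℝ => x ^ 2) (ProbabilityTheory.gaussianReal 0 1) := by
  have := (ProbabilityTheory.memLp_id_gaussianReal' (μ := 0) (v := 1) 2 (by simp)).integrable_sq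
  simpa using this

lemma aux_sq_integral :
    ∫ x : ℝ, x ^ 2 ∂(ProbabilityTheory.gaussianReal 0 1) = 1 := by
  have h := ProbabilityTheory.variance_fun_id_gaussianReal (μ := 0) (v := 1)
  rw [ProbabilityTheory.variance_of_integral_eq_zero (by fun_prop)
    (by simp)] at h
  simpa using h

lemma aux_sum_integrable (n : ℕ) (i : Fin n) :
    Integrable (fun y : Fin n → ℝ => y i ^ 2)
      (Measure.pi fun _ : Fin n => ProbabilityTheory.gaussianReal 0 1) :=
  integrable_comp_eval (μ := fun _ : Fin n => ProbabilityTheory.gaussianReal 0 1)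
    (i := i) (f := fun x : ℝ => x ^ 2) aux_sq_integrable

lemma aux_sum_integral (n : ℕ) :
    ∫ y : Fin n → ℝ, ∑ i, y i ^ 2
      ∂(Measure.pi fun _ : Fin n => ProbabilityTheory.gaussianReal 0 1) = n := by
  rw [integral_finsetSum _ (fun i _ => aux_sum_integrable n i)]
  have : ∀ i : Fin n, ∫ y : Fin n → ℝ, y i ^ 2
      ∂(Measure.pi fun _ : Fin n => ProbabilityTheory.gaussianReal 0 1) = 1 := by
    intro i
    rw [integral_comp_eval (μ := fun _ : Fin n => ProbabilityTheory.gaussianReal 0 1)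
      (i := i) (f := fun x : ℝ => x ^ 2) aux_sq_integrable.aestronglyMeasurable]
    exact aux_sq_integral
  simp [this]

/-- Deterministic step. -/
lemma aux_det (n : ℕ) (hn : 0 < n) (a q D : ℝ) (hq : 0 ≤ q) (hD : 0 < D)
    (h : |a| ≤ (Real.sqrt (1 + D))⁻¹ * Real.sqrt (a ^ 2 + q)) :
    |a| ≤ (Real.sqrt D)⁻¹ * ((q / Real.sqrt n + Real.sqrt n) / 2) := by
  have h1 : a ^ 2 * D ≤ q := by
    have h2 : |a| ^ 2 ≤ ((Real.sqrt (1 + D))⁻¹ * Real.sqrt (a ^ 2 + q)) ^ 2 :=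
      pow_le_pow_left₀ (abs_nonneg a) h 2
    rw [mul_pow, inv_pow, Real.sq_sqrt (by positivity), Real.sq_sqrt (by positivity), sq_abs,
      inv_mul_eq_div, le_div_iff₀ (by positivity)] at h2
    linarith
  have hs : 0 < Real.sqrt (n : ℝ) := Real.sqrt_pos.2 (by exact_mod_cast hn)
  have h3 : |a| * Real.sqrt D ≤ Real.sqrt q := by
    apply Real.le_sqrt_of_sq_le
    rw [mul_pow, sq_abs, Real.sq_sqrt hD.le]; exact h1
  have h4 : Real.sqrt q ≤ (q / Real.sqrt n + Real.sqrt n) / 2 := by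
    have h5 : q / Real.sqrt n + Real.sqrt n - 2 * Real.sqrt q
        = (Real.sqrt q - Real.sqrt n) ^ 2 / Real.sqrt n := by
      field_simp
      have := Real.sq_sqrt hq
      nlinarith
    have h6 : 0 ≤ (Real.sqrt q - Real.sqrt n) ^ 2 / Real.sqrt n := by positivity
    linarith
  rw [inv_mul_eq_div, le_div_iff₀ (Real.sqrt_pos.2 hD)]
  exact h3.trans h4

lemma aux_num (n : ℕ) :
    2 * Real.sqrt n * (Real.sqrt (2 * ((n + 1 : ℕ) : ℝ) ^ 3))⁻¹ / Real.sqrt (2 * Real.pi)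
      ≤ 2 / (3 * ((n + 1 : ℕ) : ℝ)) := by
  push_cast
  rw [← div_eq_mul_inv, div_div, ← Real.sqrt_mul (by positivity),
    div_le_div_iff₀ (by positivity) (by positivity)]
  have : Real.sqrt n * (3 * ((n : ℝ) + 1))
      ≤ Real.sqrt (2 * ((n : ℝ) + 1) ^ 3 * (2 * Real.pi)) := by
    apply Real.le_sqrt_of_sq_le
    rw [mul_pow, Real.sq_sqrt (by positivity)]
    have hpi := Real.pi_gt_three
    have h0 : (0 : ℝ) ≤ n := by positivity
    have hp : 0 ≤ ((n : ℝ) + 1) ^ 3 := by positivity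
    nlinarith [mul_nonneg hp (sub_nonneg.2 hpi.le), sq_nonneg ((n : ℝ) + 1)]
  linarith

lemma aux_gauss (n : ℕ) (hn : 0 < n) :
    ProbabilityTheory.stdGaussian (EuclideanSpace ℝ (Fin (n + 1)))
      {g | |g 0| ≤ (Real.sqrt (1 + 2 * ((n + 1 : ℕ) : ℝ) ^ 3))⁻¹ * ‖g‖}
      ≤ ENNReal.ofReal (2 / (3 * ((n + 1 : ℕ) : ℝ))) := by
  set D : ℝ := 2 * ((n + 1 : ℕ) : ℝ) ^ 3 with hD
  have hDpos : 0 < D := by positivity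
  have hmeas : MeasurableSet {g : EuclideanSpace ℝ (Fin (n + 1)) |
      |g 0| ≤ (Real.sqrt (1 + D))⁻¹ * ‖g‖} :=
    measurableSet_le (by fun_prop) (by fun_prop)
  rw [← ProbabilityTheory.map_pi_eq_stdGaussian, Measure.map_apply (by fun_prop) hmeas]
  set P := Measure.pi fun _ : Fin n => ProbabilityTheory.gaussianReal 0 1 with hP
  set R : (Fin n → ℝ) → ℝ := fun y =>
    (Real.sqrt D)⁻¹ * (((∑ i, y i ^ 2) / Real.sqrt n + Real.sqrt n) / 2) with hR
  have hRm : Measurable R := by fun_prop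
  have hR0 : ∀ y, 0 ≤ R y := fun y => by
    have : 0 ≤ ∑ i, y i ^ 2 := Finset.sum_nonneg fun i _ => sq_nonneg _
    simp only [hR]; positivity
  set B : Set (ℝ × (Fin n → ℝ)) := {p | |p.1| ≤ R p.2} with hB
  have hBm : MeasurableSet B := measurableSet_le (by fun_prop) (by fun_prop)
  have hmp := measurePreserving_piFinSuccAbove
    (fun _ : Fin (n + 1) => ProbabilityTheory.gaussianReal 0 1) 0
  have hsub : (WithLp.toLp 2 ⁻¹' {g : EuclideanSpace ℝ (Fin (n + 1)) |
      |g 0| ≤ (Real.sqrt (1 + D))⁻¹ * ‖g‖}) ⊆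
      (MeasurableEquiv.piFinSuccAbove (fun _ : Fin (n + 1) => ℝ) 0) ⁻¹' B := by
    intro y hy
    simp only [Set.mem_preimage, Set.mem_ofPred_eq, EuclideanSpace.norm_eq, Real.norm_eq_abs,
      sq_abs, Fin.sum_univ_succ] at hy
    have := aux_det n hn (y 0) (∑ i : Fin n, y i.succ ^ 2) D
      (Finset.sum_nonneg fun i _ => sq_nonneg _) hDpos hy
    simpa [hB, hR, MeasurableEquiv.piFinSuccAbove, Fin.removeNth, Fin.tail, Fin.insertNthEquiv] using this
  refine (measure_mono hsub).trans ?_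
  rw [hmp.measure_preimage hBm.nullMeasurableSet, Measure.prod_apply_symm hBm]
  have hint : Integrable (fun y => 2 * R y / Real.sqrt (2 * Real.pi)) P := by
    have : Integrable (fun y : Fin n → ℝ => ∑ i, y i ^ 2) P :=
      integrable_finsetSum _ fun i _ => aux_sum_integrable n i
    simp only [hR]
    exact (((((this.div_const _).add (integrable_const _)).div_const _).const_mul _).const_mul
      _).div_const _
  calc ∫⁻ y, ProbabilityTheory.gaussianReal 0 1 ((fun x => (x, y)) ⁻¹' B) ∂P
      ≤ ∫⁻ y, ENNReal.ofReal (2 * R y / Real.sqrt (2 * Real.pi)) ∂P :=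
        lintegral_mono fun y => aux_gauss_interval (R y)
    _ = ENNReal.ofReal (∫ y, 2 * R y / Real.sqrt (2 * Real.pi) ∂P) := by
        rw [ofReal_integral_eq_lintegral_ofReal hint]
        exact Filter.Eventually.of_forall fun y => by
          have := hR0 y
          show 0 ≤ 2 * R y / Real.sqrt (2 * Real.pi)
          positivity
    _ ≤ _ := by
        apply ENNReal.ofReal_le_ofReal
        refine le_trans (le_of_eq ?_) (aux_num n)
        have : Integrable (fun y : Fin n → ℝ => ∑ i, y i ^ 2) P :=
          integrable_finsetSum _ fun i _ => aux_sum_integrable n i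
        simp only [hR]
        rw [integral_div, integral_const_mul, integral_const_mul, integral_div,
          integral_add (this.div_const _) (integrable_const _), integral_div, aux_sum_integral]
        simp only [integral_const, probReal_univ, one_smul]
        rw [Real.div_sqrt]
        ring

lemma aux_rot {E : Type*} [NormedAddCommGroup E] [InnerProductSpace ℝ E] [CompleteSpace E]
    [MeasurableSpace E] [BorelSpace E] [SecondCountableTopology E]
    (ν : Measure E) (hinv : ∀ T : E ≃ₗᵢ[ℝ] E, ν.map T = ν) (v w : E) (h : ‖v‖ = ‖w‖) (ε : ℝ) :
    ν {x | |⟪x, v⟫| ≤ ε * ‖x‖} = ν {x | |⟪x, w⟫| ≤ ε * ‖x‖} := by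
  set T := (ℝ ∙ (v - w))ᗮ.reflection
  have hT : T v = w := Submodule.reflection_sub h
  have hm : MeasurableSet {x : E | |⟪x, w⟫| ≤ ε * ‖x‖} :=
    measurableSet_le (by fun_prop) (by fun_prop)
  conv_rhs => rw [← hinv T]
  rw [Measure.map_apply T.continuous.measurable hm]
  congr 1
  ext x
  simp [← hT]

/-- For `x₀` uniformly distributed on the unit sphere of `ℝ^d`
(i.e. distributed according to a rotation-invariant probability measure supported on
the unit sphere) and any fixed unit vector `u`,
`P(|⟪x₀, u⟫| ≥ 1/√(1 + 2d³)) ≥ 1 − 2/(3d)` when `d ≥ 8`. -/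
theorem init_overlap_whp {d : ℕ} (hd : 8 ≤ d)
    (μ : Measure (EuclideanSpace ℝ (Fin d))) [IsProbabilityMeasure μ]
    (hsupp : ∀ᵐ x ∂μ, ‖x‖ = 1)
    (hinv : ∀ T : EuclideanSpace ℝ (Fin d) ≃ₗᵢ[ℝ] EuclideanSpace ℝ (Fin d),
      μ.map T = μ)
    (u : EuclideanSpace ℝ (Fin d)) (hu : ‖u‖ = 1) :
    (1 : ℝ≥0∞) - 2 / (3 * (d : ℝ≥0∞))
      ≤ μ {x | (Real.sqrt (1 + 2 * (d : ℝ) ^ 3))⁻¹ ≤ |⟪x, u⟫|} := by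
  obtain ⟨n, rfl⟩ : ∃ n, d = n + 1 := ⟨d - 1, by omega⟩
  set ε := (Real.sqrt (1 + 2 * ((n + 1 : ℕ) : ℝ) ^ 3))⁻¹ with hε
  set γ := ProbabilityTheory.stdGaussian (EuclideanSpace ℝ (Fin (n + 1))) with hγ
  have hm : MeasurableSet {x : EuclideanSpace ℝ (Fin (n + 1)) | ε ≤ |⟪x, u⟫|} := measurableSet_le (by fun_prop) (by fun_prop)
  -- the key bound
  have key : μ {x : EuclideanSpace ℝ (Fin (n + 1)) | |⟪x, u⟫| ≤ ε * ‖x‖} ≤ ENNReal.ofReal (2 / (3 * ((n + 1 : ℕ) : ℝ))) := by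
    set A : Set (EuclideanSpace ℝ (Fin (n + 1)) × EuclideanSpace ℝ (Fin (n + 1))) := {p | |⟪p.1, p.2⟫| ≤ ε * ‖p.1‖ * ‖p.2‖} with hA
    have hAm : MeasurableSet A := measurableSet_le (by fun_prop) (by fun_prop)
    have h1 : ∀ g : EuclideanSpace ℝ (Fin (n + 1)), μ {x : EuclideanSpace ℝ (Fin (n + 1)) | |⟪x, u⟫| ≤ ε * ‖x‖} ≤ μ ((fun x => (x, g)) ⁻¹' A) := by
      intro g
      rcases eq_or_ne g 0 with rfl | hg
      · refine measure_mono fun x _ => ?_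
        simp [hA]
      · have hg' : 0 < ‖g‖ := norm_pos_iff.2 hg
        have hn1 : ‖u‖ = ‖(‖g‖⁻¹ • g)‖ := by
          rw [hu, norm_smul, norm_inv, norm_norm, inv_mul_cancel₀ hg'.ne']
        rw [aux_rot μ hinv u (‖g‖⁻¹ • g) hn1 ε]
        refine measure_mono fun x hx => ?_
        simp only [Set.mem_ofPred_eq, real_inner_smul_right, abs_mul, abs_inv, abs_norm] at hx
        rw [inv_mul_le_iff₀ hg'] at hx
        show |⟪x, g⟫| ≤ ε * ‖x‖ * ‖g‖
        linarith
    have h2 : ∀ᵐ x ∂μ, γ (Prod.mk x ⁻¹' A) ≤ ENNReal.ofReal (2 / (3 * ((n + 1 : ℕ) : ℝ))) := by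
      filter_upwards [hsupp] with x hx
      have hx : ‖x‖ = 1 := hx
      have h3 : Prod.mk x ⁻¹' A = {g : EuclideanSpace ℝ (Fin (n + 1)) | |⟪g, x⟫| ≤ ε * ‖g‖} := by
        ext g
        simp [hA, hx, real_inner_comm]
      have hγinv : ∀ T : EuclideanSpace ℝ (Fin (n + 1)) ≃ₗᵢ[ℝ] EuclideanSpace ℝ (Fin (n + 1)), γ.map T = γ := fun T => ProbabilityTheory.stdGaussian_map T
      rw [h3, aux_rot γ hγinv x (EuclideanSpace.single 0 1) (by simp [hx]) ε]
      refine le_trans (le_of_eq ?_) (aux_gauss n (by omega))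
      congr 1
      ext g
      simp [hε, EuclideanSpace.inner_single_right]
    calc μ {x : EuclideanSpace ℝ (Fin (n + 1)) | |⟪x, u⟫| ≤ ε * ‖x‖}
        = ∫⁻ _g, μ {x : EuclideanSpace ℝ (Fin (n + 1)) | |⟪x, u⟫| ≤ ε * ‖x‖} ∂γ := by simp
      _ ≤ ∫⁻ g, μ ((fun x => (x, g)) ⁻¹' A) ∂γ := lintegral_mono h1
      _ = (μ.prod γ) A := (Measure.prod_apply_symm hAm).symm
      _ = ∫⁻ x, γ (Prod.mk x ⁻¹' A) ∂μ := Measure.prod_apply hAm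
      _ ≤ ∫⁻ _x, ENNReal.ofReal (2 / (3 * ((n + 1 : ℕ) : ℝ))) ∂μ := lintegral_mono_ae h2
      _ = _ := by simp
  have hc : μ {x : EuclideanSpace ℝ (Fin (n + 1)) | ε ≤ |⟪x, u⟫|}ᶜ ≤ 2 / (3 * ((n + 1 : ℕ) : ℝ≥0∞)) := by
    have h4 : μ {x : EuclideanSpace ℝ (Fin (n + 1)) | ε ≤ |⟪x, u⟫|}ᶜ ≤ μ {x : EuclideanSpace ℝ (Fin (n + 1)) | |⟪x, u⟫| ≤ ε * ‖x‖} := by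
      refine measure_mono_ae ?_
      filter_upwards [hsupp] with x hx hx2
      have : ¬ ε ≤ |⟪x, u⟫| := hx2
      show |⟪x, u⟫| ≤ ε * ‖x‖
      rw [hx]; linarith
    refine (h4.trans key).trans (le_of_eq ?_)
    rw [ENNReal.ofReal_div_of_pos (by positivity), ENNReal.ofReal_mul (by norm_num),
      ENNReal.ofReal_natCast]
    simp
  rw [prob_compl_eq_one_sub hm] at hc
  exact tsub_le_iff_tsub_le.1 hc
end

section
/- Under Assumption: Σ symmetric with eigenvalues 1 = λ₁* > ⋯ > λ_d* > 0, eigengaps 𝒯_j = λ_j* − λ_{j+1}* (𝒯_d = λ_d*), 𝒯_{K,min} = min_{k≤K} 𝒯_k, inexact deflation producing v_k = u_k + δ_k where u_k is the top unit eigenvector of Σ_k (sign-aligned with u_k*). If ∑_{k'=1}^{k−1} λ_{k'}* ‖δ_{k'}‖₂ ∏_{j=k'+1}^{k−1} (3 + 2λ_j*/𝒯_j) ≤ 𝒯_{K,min}/20 for all k ≤ K, then for all k ∈ [K]: ‖v_k − u_k*‖₂ ≤ 5 ∑_{k'=1}^{k} (λ_{k'}*/λ_k*) ‖δ_{k'}‖₂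 ∏_{j=k'+1}^{k} (3 + 2λ_j*/𝒯_j). -/
open Matrix Finset

/-- Euclidean norm of a vector in `Fin d → ℝ`. -/
noncomputable def vnorm {d : ℕ} (x : Fin d → ℝ) : ℝ := Real.sqrt (∑ i, x i ^ 2)

theorem le_of_sq_le_aux {a b : ℝ} (h : a ^ 2 ≤ b ^ 2) (hb : 0 ≤ b) : a ≤ b :=
  (abs_le_of_sq_le_sq' h hb).2

theorem vnorm_nonneg' {d : ℕ} (x : Fin d → ℝ) : 0 ≤ vnorm x := Real.sqrt_nonneg _

theorem dot_self_nonneg' {d : ℕ} (x : Fin d → ℝ) : 0 ≤ x ⬝ᵥ x :=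
  Finset.sum_nonneg fun i _ => mul_self_nonneg (x i)

theorem vnorm_sq {d : ℕ} (x : Fin d → ℝ) : vnorm x ^ 2 = x ⬝ᵥ x := by
  unfold vnorm
  rw [Real.sq_sqrt (Finset.sum_nonneg fun i _ => sq_nonneg _)]
  simp [dotProduct, sq]

theorem cs_dot {d : ℕ} (x y : Fin d → ℝ) : (x ⬝ᵥ y) ^ 2 ≤ (x ⬝ᵥ x) * (y ⬝ᵥ y) := by
  have := Finset.sum_mul_sq_le_sq_mul_sq Finset.univ x y
  simpa [dotProduct, sq] using this

theorem vnorm_add_le' {d : ℕ} (x y : Fin d → ℝ) : vnorm (x + y) ≤ vnorm x + vnorm y := by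
  have hx := vnorm_nonneg' x
  have hy := vnorm_nonneg' y
  apply le_of_sq_le_aux _ (by positivity)
  have h1 : x ⬝ᵥ y ≤ vnorm x * vnorm y := by
    apply le_of_sq_le_aux _ (by positivity)
    rw [mul_pow, vnorm_sq, vnorm_sq]; exact cs_dot x y
  have h2 := vnorm_sq (x + y)
  simp only [add_dotProduct, dotProduct_add] at h2
  rw [dotProduct_comm y x] at h2
  nlinarith [vnorm_sq x, vnorm_sq y]

theorem rank_two_bound {d : ℕ} (u v x : Fin d → ℝ) (hu : u ⬝ᵥ u = 1) (hv : v ⬝ᵥ v = 1) :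
    |(u ⬝ᵥ x) ^ 2 - (v ⬝ᵥ x) ^ 2| ≤ vnorm (u - v) * (x ⬝ᵥ x) := by
  set p := u - v with hp
  set q := u + v with hq
  have hm := vnorm_nonneg' p
  have hn := vnorm_nonneg' q
  have hm2 := vnorm_sq p
  have hn2 := vnorm_sq q
  have hpq : p ⬝ᵥ q = 0 := by
    simp only [hp, hq, sub_dotProduct, dotProduct_add, dotProduct_comm v u, hu, hv]; ring
  have hsum : p ⬝ᵥ p + q ⬝ᵥ q = 4 := by
    simp only [hp, hq, sub_dotProduct, dotProduct_sub, add_dotProduct, dotProduct_add,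
      dotProduct_comm v u, hu, hv]; ring
  have hx := dot_self_nonneg' x
  have hPQ : (u ⬝ᵥ x) ^ 2 - (v ⬝ᵥ x) ^ 2 = (p ⬝ᵥ x) * (q ⬝ᵥ x) := by
    simp only [hp, hq, sub_dotProduct, add_dotProduct]; ring
  rw [hPQ]
  have hcp := cs_dot p x
  have hcq := cs_dot q x
  set m := vnorm p
  set n := vnorm q
  rw [← hm2] at hcp hsum
  rw [← hn2] at hcq hsum
  have hn_le : n ≤ 2 := by nlinarith
  set P := p ⬝ᵥ x with hP
  set Q := q ⬝ᵥ x with hQ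
  rcases hm.eq_or_lt with h0 | hmp
  · have : P = 0 := by rw [← h0] at hcp; nlinarith
    rw [this, ← h0]; simp
  rcases hn.eq_or_lt with h0 | hnp
  · have : Q = 0 := by rw [← h0] at hcq; nlinarith
    rw [this]; simp; positivity
  have key : 0 ≤ (m^2*n^2) * (m^2*n^2*(x ⬝ᵥ x) - n^2*P^2 - m^2*Q^2) := by
    have h := dot_self_nonneg' ((m^2*n^2) • x - (n^2*P) • p - (m^2*Q) • q)
    simp only [sub_dotProduct, dotProduct_sub, smul_dotProduct, dotProduct_smul, smul_eq_mul,
      dotProduct_comm x p, dotProduct_comm x q, dotProduct_comm q p, hpq, ← hm2, ← hn2,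
      ← hP, ← hQ] at h
    linarith
  have key2 := nonneg_of_mul_nonneg_right key (by positivity)
  have h3 : 2 * (m * n) * |P * Q| ≤ (m * n) * (m * n * (x ⬝ᵥ x)) := by
    rw [abs_mul]
    nlinarith [sq_nonneg (n * |P| - m * |Q|), sq_abs P, sq_abs Q]
  have h4 : 2 * |P * Q| ≤ m * n * (x ⬝ᵥ x) := by
    have : 0 < m * n := by positivity
    nlinarith
  have h5 : m * n * (x ⬝ᵥ x) ≤ m * 2 * (x ⬝ᵥ x) := by gcongr
  linarith

theorem polar {d : ℕ} (M : Matrix (Fin d) (Fin d) ℝ) (hM : M.IsSymm) (e : ℝ)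
    (hQ : ∀ x, |x ⬝ᵥ M *ᵥ x| ≤ e * (x ⬝ᵥ x)) (x y : Fin d → ℝ) :
    2 * (x ⬝ᵥ M *ᵥ y) ≤ e * (x ⬝ᵥ x + y ⬝ᵥ y) := by
  have hs : y ⬝ᵥ M *ᵥ x = x ⬝ᵥ M *ᵥ y := by
    rw [dotProduct_mulVec, ← mulVec_transpose, hM.eq, dotProduct_comm]
  have h1 := (abs_le.1 (hQ (x + y))).2
  have h2 := (abs_le.1 (hQ (x - y))).1
  simp only [mulVec_add, mulVec_sub, add_dotProduct, dotProduct_add, sub_dotProduct,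
    dotProduct_sub, hs, dotProduct_comm y x] at h1 h2
  linarith

theorem davis_kahan {d : ℕ} (A S : Matrix (Fin d) (Fin d) ℝ) (hA : A.IsSymm) (hS : S.IsSymm)
    (us u : Fin d → ℝ) (l T e lam : ℝ) (hus : us ⬝ᵥ us = 1) (hu : u ⬝ᵥ u = 1)
    (hAus : A *ᵥ us = l • us)
    (hAgap : ∀ w, us ⬝ᵥ w = 0 → w ⬝ᵥ A *ᵥ w ≤ (l - T) * (w ⬝ᵥ w))
    (hQ : ∀ x, |x ⬝ᵥ (S - A) *ᵥ x| ≤ e * (x ⬝ᵥ x))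
    (hT : 0 < T) (he0 : 0 ≤ e) (he : e ≤ T / 4)
    (hSu : S *ᵥ u = lam • u) (hlam : l - e ≤ lam) (hsign : 0 ≤ u ⬝ᵥ us) :
    vnorm (u - us) ≤ 2 / T * e := by
  set c := u ⬝ᵥ us with hc
  set w := u - c • us with hw
  have hsu : us ⬝ᵥ u = c := dotProduct_comm _ _
  have hwo : us ⬝ᵥ w = 0 := by
    simp [hw, dotProduct_sub, hus, hsu]
  have hww : w ⬝ᵥ w = 1 - c ^ 2 := by
    simp only [hw, sub_dotProduct, dotProduct_sub, smul_dotProduct, dotProduct_smul, smul_eq_mul,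
      hus, hu, hsu, ← hc]; ring
  have hwu : w ⬝ᵥ u = 1 - c ^ 2 := by
    simp only [hw, sub_dotProduct, smul_dotProduct, smul_eq_mul, hu, hsu]; ring
  set s := vnorm w with hs
  have hs0 : 0 ≤ s := vnorm_nonneg' w
  have hs2 : s ^ 2 = w ⬝ᵥ w := vnorm_sq w
  have hp := polar (S - A) (hS.sub hA) e hQ w (s • u)
  have hdecomp : u = c • us + w := by simp [hw]
  have hAu : w ⬝ᵥ A *ᵥ u = w ⬝ᵥ A *ᵥ w := by
    conv_lhs => rw [hdecomp, mulVec_add, mulVec_smul, hAus]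
    simp [dotProduct_add, dotProduct_comm w us, hwo]
  have hg := hAgap w hwo
  have h1 : w ⬝ᵥ (S - A) *ᵥ (s • u) = s * (lam * s ^ 2 - w ⬝ᵥ A *ᵥ w) := by
    rw [mulVec_smul, dotProduct_smul, sub_mulVec, dotProduct_sub, hSu, dotProduct_smul, hwu, hAu,
      hs2, hww]; simp
  rw [h1] at hp
  simp only [smul_dotProduct, dotProduct_smul, hu, smul_eq_mul] at hp
  rw [← hs2] at hp hg
  have h2 : s * ((T - e) * s ^ 2) ≤ e * s ^ 2 := by
    have : s * ((T - e) * s ^ 2) ≤ s * (lam * s ^ 2 - w ⬝ᵥ A *ᵥ w) := by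
      apply mul_le_mul_of_nonneg_left _ hs0
      nlinarith [sq_nonneg s]
    linarith
  have h3 : (T - e) * s ≤ e := by
    rcases hs0.eq_or_lt with h0 | h0
    · rw [← h0]; simpa using he0
    · have : 0 < s ^ 2 := by positivity
      nlinarith
  have h4 : s ≤ 4 / 3 * (e / T) := by
    have : T * s ≤ 4 / 3 * e := by nlinarith
    rw [show 4 / 3 * (e / T) = (4 / 3 * e) / T by ring, le_div_iff₀ hT]; linarith
  have hr : 2 / T * e = 2 * (e / T) := by ring
  have hr0 : 0 ≤ e / T := by positivity
  rw [hr]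
  apply le_of_sq_le_aux _ (by positivity)
  rw [vnorm_sq]
  have h5 : (u - us) ⬝ᵥ (u - us) = 2 - 2 * c := by
    simp only [sub_dotProduct, dotProduct_sub, hus, hu, hsu, ← hc]; ring
  rw [h5]
  have h6 : s ^ 2 = 1 - c ^ 2 := by rw [hs2, hww]
  have hc1 : c ≤ 1 := by nlinarith [sq_nonneg s]
  nlinarith

set_option maxHeartbeats 1000000 in
theorem deflation_step {d : ℕ} (A S S' A' : Matrix (Fin d) (Fin d) ℝ)
    (hA : A.IsSymm) (hS : S.IsSymm)
    (us u v dl : Fin d → ℝ) (l T e lam : ℝ) (hus : us ⬝ᵥ us = 1) (hu : u ⬝ᵥ u = 1)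
    (hv : v ⬝ᵥ v = 1) (hvd : v = u + dl)
    (hAus : A *ᵥ us = l • us)
    (hAgap : ∀ w, us ⬝ᵥ w = 0 → w ⬝ᵥ A *ᵥ w ≤ (l - T) * (w ⬝ᵥ w))
    (hAnn : ∀ w, 0 ≤ w ⬝ᵥ A *ᵥ w) (hAle : ∀ w, w ⬝ᵥ A *ᵥ w ≤ l * (w ⬝ᵥ w))
    (hQ : ∀ x, |x ⬝ᵥ (S - A) *ᵥ x| ≤ e * (x ⬝ᵥ x))
    (hT : 0 < T) (hTl : T ≤ l) (he0 : 0 ≤ e) (he : e ≤ T / 4)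
    (hSu : S *ᵥ u = lam • u) (hsign : 0 ≤ u ⬝ᵥ us)
    (htop : ∀ x, x ⬝ᵥ S *ᵥ x ≤ lam * (x ⬝ᵥ x))
    (hA' : A' = A - l • vecMulVec us us)
    (hS' : S' = S - vecMulVec v v * S * vecMulVec v v) :
    vnorm (u - us) ≤ 2 / T * e ∧ S'.IsSymm ∧
    ∀ x, |x ⬝ᵥ (S' - A') *ᵥ x| ≤ ((3 + 2 * l / T) * e + 5 * (l * vnorm dl)) * (x ⬝ᵥ x) := by
  have hQ' : ∀ x, |x ⬝ᵥ S *ᵥ x - x ⬝ᵥ A *ᵥ x| ≤ e * (x ⬝ᵥ x) := by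
    intro x; have := hQ x; rwa [sub_mulVec, dotProduct_sub] at this
  have hlam1 : l - e ≤ lam := by
    have h1 := htop us
    have h2 := (abs_le.1 (hQ' us)).1
    rw [hAus, dotProduct_smul, hus] at h2
    rw [hus] at h1
    simp only [smul_eq_mul] at h2
    linarith
  have hlam2 : lam ≤ l + e := by
    have h2 := (abs_le.1 (hQ' u)).2
    have h3 := hAle u
    rw [hSu, dotProduct_smul, hu] at h2
    rw [hu] at h3
    simp only [smul_eq_mul] at h2
    linarith
  have hdk := davis_kahan A S hA hS us u l T e lam hus hu hAus hAgap hQ hT he0 he hSu hlam1 hsign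
  refine ⟨hdk, ?_, ?_⟩
  · rw [hS']
    have : (vecMulVec v v * S * vecMulVec v v).IsSymm := by
      unfold Matrix.IsSymm
      rw [transpose_mul, transpose_mul, hS.eq, transpose_vecMulVec, Matrix.mul_assoc]
    exact hS.sub this
  intro x
  set c := v ⬝ᵥ S *ᵥ v with hc
  have hx := dot_self_nonneg' x
  have hform : x ⬝ᵥ (S' - A') *ᵥ x =
      (x ⬝ᵥ S *ᵥ x - x ⬝ᵥ A *ᵥ x) - c * (v ⬝ᵥ x) ^ 2 + l * (us ⬝ᵥ x) ^ 2 := by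
    rw [hS', hA']
    have e1 : (vecMulVec v v * S * vecMulVec v v) *ᵥ x = (c * (v ⬝ᵥ x)) • v := by
      rw [← mulVec_mulVec, ← mulVec_mulVec, vecMulVec_mulVec, vecMulVec_mulVec]
      ext i
      simp [mulVec_smul, dotProduct_smul, hc]
      ring
    have e2 : (l • vecMulVec us us) *ᵥ x = (l * (us ⬝ᵥ x)) • us := by
      rw [smul_mulVec, vecMulVec_mulVec]
      ext i
      simp
      ring
    simp only [sub_mulVec, e1, e2, dotProduct_sub, dotProduct_smul, smul_eq_mul,
      dotProduct_comm x v, dotProduct_comm x us]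
    ring
  -- rank-two terms
  have r1 := rank_two_bound u us x hu hus
  have r2 := rank_two_bound v u x hv hu
  have hvu : v - u = dl := by rw [hvd]; simp
  rw [hvu] at r2
  set D := vnorm dl with hD
  have hD0 : 0 ≤ D := vnorm_nonneg' dl
  have hD2 : D ^ 2 = dl ⬝ᵥ dl := vnorm_sq dl
  have hudl : 2 * (u ⬝ᵥ dl) = - D ^ 2 := by
    have := hv
    rw [hvd] at this
    simp only [add_dotProduct, dotProduct_add, dotProduct_comm dl u, hu] at this
    linarith
  have hDle : D ≤ 2 := by
    have h1 := cs_dot u dl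
    rw [hu, ← hD2] at h1
    have h2 : u ⬝ᵥ dl = - D ^ 2 / 2 := by linarith
    rw [h2] at h1
    by_contra hcon
    have h3 : 4 < D ^ 2 := by nlinarith
    nlinarith
  have hSud : u ⬝ᵥ S *ᵥ dl = lam * (u ⬝ᵥ dl) := by
    rw [dotProduct_mulVec, ← mulVec_transpose, hS.eq, hSu]; simp
  have hcval : c = lam - lam * D ^ 2 + dl ⬝ᵥ S *ᵥ dl := by
    rw [hc, hvd]
    simp only [mulVec_add, add_dotProduct, dotProduct_add, hSu, hSud, dotProduct_smul,
      smul_eq_mul, hu, dotProduct_comm dl u]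
    linear_combination lam * hudl
  have hl0 : 0 < l := by linarith
  have hc1 : c ≤ lam := by
    have := htop dl
    rw [← hD2] at this
    linarith
  have hc2 : lam - c ≤ 3 * l * D := by
    have h1 := (abs_le.1 (hQ' dl)).1
    have h2 := hAnn dl
    rw [← hD2] at h1
    have h3 : lam - c ≤ (lam + e) * D ^ 2 := by linarith
    have h4 : (lam + e) * D ^ 2 ≤ (3 / 2 * l) * (2 * D) := by
      apply mul_le_mul <;> nlinarith
    linarith
  have hux : (u ⬝ᵥ x) ^ 2 ≤ x ⬝ᵥ x := by simpa [hu] using cs_dot u x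
  have hvx : (v ⬝ᵥ x) ^ 2 ≤ x ⬝ᵥ x := by simpa [hv] using cs_dot v x
  have t1 : |l * ((u ⬝ᵥ x) ^ 2 - (us ⬝ᵥ x) ^ 2)| ≤ 2 * l / T * e * (x ⬝ᵥ x) := by
    rw [abs_mul, abs_of_pos hl0]
    calc l * _ ≤ l * ((2 / T * e) * (x ⬝ᵥ x)) := by
          apply mul_le_mul_of_nonneg_left _ hl0.le
          exact r1.trans (mul_le_mul_of_nonneg_right hdk hx)
      _ = _ := by ring
  have t2 : |(l - lam) * (u ⬝ᵥ x) ^ 2| ≤ e * (x ⬝ᵥ x) := by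
    rw [abs_mul, abs_of_nonneg (sq_nonneg (u ⬝ᵥ x))]
    apply mul_le_mul _ hux (sq_nonneg _) he0
    rw [abs_le]; constructor <;> linarith
  have t3 : |lam * ((v ⬝ᵥ x) ^ 2 - (u ⬝ᵥ x) ^ 2)| ≤ 2 * l * (D * (x ⬝ᵥ x)) := by
    rw [abs_mul, abs_of_nonneg (by linarith : 0 ≤ lam)]
    apply mul_le_mul _ r2 (abs_nonneg _) <;> linarith
  have t4 : |(lam - c) * (v ⬝ᵥ x) ^ 2| ≤ 3 * l * D * (x ⬝ᵥ x) := by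
    rw [abs_mul, abs_of_nonneg (sq_nonneg (v ⬝ᵥ x)), abs_of_nonneg (by linarith : 0 ≤ lam - c)]
    apply mul_le_mul hc2 hvx (sq_nonneg _) (by positivity)
  have t0 := hQ' x
  have he2 : 0 ≤ e * (x ⬝ᵥ x) := by positivity
  rw [hform]
  have a0 := abs_le.1 t0
  have a1 := abs_le.1 t1
  have a2 := abs_le.1 t2
  have a3 := abs_le.1 t3
  have a4 := abs_le.1 t4
  rw [abs_le]
  have hexp : ((3 + 2 * l / T) * e + 5 * (l * D)) * (x ⬝ᵥ x) = 3 * (e * (x ⬝ᵥ x)) +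
      2 * l / T * e * (x ⬝ᵥ x) + 2 * l * (D * (x ⬝ᵥ x)) + 3 * l * D * (x ⬝ᵥ x) := by ring
  rw [hexp]
  constructor <;> linarith [a0.1, a0.2, a1.1, a1.2, a2.1, a2.2, a3.1, a3.2, a4.1, a4.2]

theorem basis_parseval {d : ℕ} (us : ℕ → Fin d → ℝ)
    (hortho : ∀ i j, i < d → j < d → us i ⬝ᵥ us j = if i = j then 1 else 0)
    (x y : Fin d → ℝ) :
    x ⬝ᵥ y = ∑ j ∈ range d, (us j ⬝ᵥ x) * (us j ⬝ᵥ y) := by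
  let U : Matrix (Fin d) (Fin d) ℝ := Matrix.of fun i j => us i j
  have h1 : U * Uᵀ = 1 := by
    ext i j
    have := hortho i j i.2 j.2
    simp only [Matrix.mul_apply, Matrix.transpose_apply, Matrix.one_apply, U, Matrix.of_apply]
    simpa [dotProduct, Fin.ext_iff] using this
  have h2 : Uᵀ * U = 1 := mul_eq_one_comm.1 h1
  rw [Finset.sum_range]
  have h3 : (U *ᵥ x) ⬝ᵥ (U *ᵥ y) = x ⬝ᵥ y := by
    rw [dotProduct_mulVec, ← mulVec_transpose, mulVec_mulVec, h2, one_mulVec]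
  rw [← h3]
  rfl

/-- The ideal deflated matrix. -/
noncomputable def idealA {d : ℕ} (l : ℕ → ℝ) (us : ℕ → Fin d → ℝ) (k : ℕ) :
    Matrix (Fin d) (Fin d) ℝ := ∑ j ∈ Finset.Ico k d, l j • vecMulVec (us j) (us j)

theorem idealA_mulVec {d : ℕ} (l : ℕ → ℝ) (us : ℕ → Fin d → ℝ) (k : ℕ) (x : Fin d → ℝ) :
    idealA l us k *ᵥ x = ∑ j ∈ Finset.Ico k d, (l j * (us j ⬝ᵥ x)) • us j := by
  unfold idealA
  rw [Matrix.sum_mulVec]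
  refine Finset.sum_congr rfl fun j _ => ?_
  rw [smul_mulVec, vecMulVec_mulVec]
  ext i
  simp
  ring

theorem idealA_quad {d : ℕ} (l : ℕ → ℝ) (us : ℕ → Fin d → ℝ) (k : ℕ) (x : Fin d → ℝ) :
    x ⬝ᵥ idealA l us k *ᵥ x = ∑ j ∈ Finset.Ico k d, l j * (us j ⬝ᵥ x) ^ 2 := by
  rw [idealA_mulVec, dotProduct_sum]
  refine Finset.sum_congr rfl fun j _ => ?_
  rw [dotProduct_smul, dotProduct_comm x, smul_eq_mul]; ring

theorem idealA_symm {d : ℕ} (l : ℕ → ℝ) (us : ℕ → Fin d → ℝ) (k : ℕ) :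
    (idealA l us k).IsSymm := by
  unfold idealA Matrix.IsSymm
  rw [transpose_sum]
  refine Finset.sum_congr rfl fun j _ => ?_
  rw [transpose_smul, transpose_vecMulVec]

theorem idealA_succ {d : ℕ} (l : ℕ → ℝ) (us : ℕ → Fin d → ℝ) (k : ℕ) (hk : k < d) :
    idealA l us (k + 1) = idealA l us k - l k • vecMulVec (us k) (us k) := by
  unfold idealA
  rw [Finset.sum_eq_sum_Ico_succ_bot hk]; simp

/-- Sub-routine agnostic error propagation of inexact Hotelling's
deflation (indices are shifted by one: `Σ_k` is `S (k-1)`, `λ_k*` is `lamstar (k-1)`,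
`u_k*` is `ustar (k-1)`, `𝒯_j` is `T (j-1)`, etc.). -/
theorem inexact_deflation_error_propagation {d K : ℕ} (hK : 0 < K) (hKd : K ≤ d)
    (Sig : Matrix (Fin d) (Fin d) ℝ) (hsym : Sig.IsSymm)
    (lamstar : ℕ → ℝ) (ustar : ℕ → Fin d → ℝ)
    (hlam1 : lamstar 0 = 1)
    (hdec : ∀ i j, i < j → j < d → lamstar j < lamstar i)
    (hpos : ∀ j, j < d → 0 < lamstar j)
    (hunit : ∀ j, j < d → vnorm (ustar j) = 1)
    (hortho : ∀ i j, i < d → j < d → ustar i ⬝ᵥ ustar j = if i = j then 1 else 0)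
    (heig : ∀ j, j < d → Sig.mulVec (ustar j) = lamstar j • ustar j)
    (T : ℕ → ℝ)
    (hT : ∀ j, j + 1 < d → T j = lamstar j - lamstar (j + 1))
    (hTlast : T (d - 1) = lamstar (d - 1))
    (TKmin : ℝ) (hTKmin : TKmin = sInf {x : ℝ | ∃ k, k < K ∧ x = T k})
    (S : ℕ → Matrix (Fin d) (Fin d) ℝ)
    (v u δ : ℕ → Fin d → ℝ)
    (hS0 : S 0 = Sig)
    (hSrec : ∀ k, S (k + 1) =
      S k - vecMulVec (v k) (v k) * S k * vecMulVec (v k) (v k))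
    (lam : ℕ → ℝ)
    (hueig : ∀ k, k < K → (S k).mulVec (u k) = lam k • u k)
    (huunit : ∀ k, k < K → vnorm (u k) = 1)
    (hutop : ∀ k, k < K → ∀ x : Fin d → ℝ, x ⬝ᵥ (S k).mulVec x ≤ lam k * (x ⬝ᵥ x))
    (husign : ∀ k, k < K → 0 ≤ u k ⬝ᵥ ustar k)
    (hvdef : ∀ k, k < K → v k = u k + δ k)
    (hvunit : ∀ k, k < K → vnorm (v k) = 1)
    (hsmall : ∀ k, k < K →
      ∑ k' ∈ Finset.range k, lamstar k' * vnorm (δ k') *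
        ∏ j ∈ Finset.Ico (k' + 1) k, (3 + 2 * lamstar j / T j)
      ≤ TKmin / 20) :
    ∀ k, k < K →
      vnorm (v k - ustar k)
        ≤ 5 * ∑ k' ∈ Finset.range (k + 1), (lamstar k' / lamstar k) * vnorm (δ k') *
            ∏ j ∈ Finset.Ico (k' + 1) (k + 1), (3 + 2 * lamstar j / T j) := by
  have hd : ∀ j, j < d → ustar j ⬝ᵥ ustar j = 1 := fun j hj => by simpa using hortho j j hj hj
  have hTpos : ∀ k, k < d → 0 < T k ∧ T k ≤ lamstar k := by
    intro k hk
    by_cases h : k + 1 < d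
    · rw [hT k h]
      have := hdec k (k + 1) (by omega) h
      have := hpos (k + 1) h
      constructor <;> linarith
    · have : k = d - 1 := by omega
      subst this
      rw [hTlast]
      exact ⟨hpos _ hk, le_rfl⟩
  have hTmin : ∀ k, k < K → TKmin ≤ T k := by
    intro k hk
    rw [hTKmin]
    refine csInf_le ⟨0, ?_⟩ ⟨k, hk, rfl⟩
    rintro x ⟨j, hj, rfl⟩
    exact (hTpos j (by omega)).1.le
  have hlamle : ∀ i j, i ≤ j → j < d → lamstar j ≤ lamstar i := by
    intro i j hij hj
    rcases hij.eq_or_lt with h | h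
    · rw [h]
    · exact (hdec i j h hj).le
  set A := idealA lamstar ustar with hAdef
  have hAus : ∀ k, k < d → A k *ᵥ ustar k = lamstar k • ustar k := by
    intro k hk
    rw [hAdef, idealA_mulVec, Finset.sum_eq_single k]
    · rw [hd k hk, mul_one]
    · intro j hj hjk
      rw [hortho j k (Finset.mem_Ico.1 hj).2 hk, if_neg hjk]; simp
    · intro h; exact absurd (Finset.mem_Ico.2 ⟨le_rfl, hk⟩) h
  have hAnn : ∀ k w, 0 ≤ w ⬝ᵥ A k *ᵥ w := by
    intro k w
    rw [hAdef, idealA_quad]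
    exact Finset.sum_nonneg fun j hj =>
      mul_nonneg (hpos j (Finset.mem_Ico.1 hj).2).le (sq_nonneg _)
  have hpars : ∀ k w, ∑ j ∈ Finset.Ico k d, (ustar j ⬝ᵥ w) ^ 2 ≤ w ⬝ᵥ w := by
    intro k w
    rw [basis_parseval ustar hortho w w]
    simp only [← sq]
    apply Finset.sum_le_sum_of_subset_of_nonneg
    · intro j hj; exact Finset.mem_range.2 (Finset.mem_Ico.1 hj).2
    · intros; positivity
  have hAle : ∀ k, k < d → ∀ w, w ⬝ᵥ A k *ᵥ w ≤ lamstar k * (w ⬝ᵥ w) := by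
    intro k hk w
    rw [hAdef, idealA_quad]
    refine le_trans ?_ (mul_le_mul_of_nonneg_left (hpars k w) (hpos k hk).le)
    rw [Finset.mul_sum]
    exact Finset.sum_le_sum fun j hj => mul_le_mul_of_nonneg_right
      (hlamle k j (Finset.mem_Ico.1 hj).1 (Finset.mem_Ico.1 hj).2) (sq_nonneg _)
  have hAgap : ∀ k, k < d → ∀ w, ustar k ⬝ᵥ w = 0 →
      w ⬝ᵥ A k *ᵥ w ≤ (lamstar k - T k) * (w ⬝ᵥ w) := by
    intro k hk w hw
    rw [hAdef, idealA_quad, Finset.sum_eq_sum_Ico_succ_bot hk, hw]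
    have hnn : 0 ≤ lamstar k - T k := by linarith [(hTpos k hk).2]
    refine le_trans ?_ (mul_le_mul_of_nonneg_left (hpars (k + 1) w) hnn)
    rw [Finset.mul_sum]
    simp only [ne_eq, OfNat.ofNat_ne_zero, not_false_eq_true, zero_pow, mul_zero, zero_add]
    refine Finset.sum_le_sum fun j hj => mul_le_mul_of_nonneg_right ?_ (sq_nonneg _)
    have hj' := Finset.mem_Ico.1 hj
    rw [hT k (by omega)]
    have := hlamle (k + 1) j hj'.1 hj'.2
    linarith
  have hA0 : ∀ x, x ⬝ᵥ Sig *ᵥ x = x ⬝ᵥ A 0 *ᵥ x := by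
    intro x
    rw [hAdef, idealA_quad, basis_parseval ustar hortho, Finset.range_eq_Ico]
    refine Finset.sum_congr rfl fun j hj => ?_
    have : ustar j ⬝ᵥ Sig *ᵥ x = lamstar j * (ustar j ⬝ᵥ x) := by
      rw [dotProduct_mulVec, ← mulVec_transpose, hsym.eq, heig j (Finset.mem_Ico.1 hj).2]; simp
    rw [this]; ring
  set r : ℕ → ℝ := fun j => 3 + 2 * lamstar j / T j with hr
  set e : ℕ → ℝ := fun k => 5 * ∑ k' ∈ Finset.range k, lamstar k' * vnorm (δ k') *
        ∏ j ∈ Finset.Ico (k' + 1) k, r j with he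
  have hrpos : ∀ j, j < d → 0 ≤ r j := by
    intro j hj
    have := (hTpos j hj).1
    have := hpos j hj
    simp only [hr]; positivity
  have he0 : ∀ k, k < K → 0 ≤ e k := by
    intro k hk
    refine mul_nonneg (by norm_num) (Finset.sum_nonneg fun i hi => ?_)
    have := Finset.mem_range.1 hi
    refine mul_nonneg (mul_nonneg (hpos i (by omega)).le (vnorm_nonneg' _))
      (Finset.prod_nonneg fun j hj => hrpos j ?_)
    have := Finset.mem_Ico.1 hj
    omega
  have heT : ∀ k, k < K → e k ≤ T k / 4 := by
    intro k hk
    have h1 := hsmall k hk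
    have h2 := hTmin k hk
    simp only [he, hr]
    linarith
  have hprod : ∀ k, ∑ k' ∈ Finset.range k, lamstar k' * vnorm (δ k') *
        ∏ j ∈ Finset.Ico (k' + 1) (k + 1), r j = r k * ∑ k' ∈ Finset.range k,
        lamstar k' * vnorm (δ k') * ∏ j ∈ Finset.Ico (k' + 1) k, r j := by
    intro k
    rw [Finset.mul_sum]
    refine Finset.sum_congr rfl fun i hi => ?_
    have := Finset.mem_range.1 hi
    rw [Finset.prod_Ico_succ_top (by omega)]; ring
  have hesucc : ∀ k, e (k + 1) = r k * e k + 5 * (lamstar k * vnorm (δ k)) := by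
    intro k
    simp only [he]
    rw [Finset.sum_range_succ, hprod k]
    simp
    ring
  have hone : ∀ x : Fin d → ℝ, vnorm x = 1 → x ⬝ᵥ x = 1 := by
    intro x hx; rw [← vnorm_sq, hx]; norm_num
  have hstep : ∀ k, k < K → (S k).IsSymm →
      (∀ x, |x ⬝ᵥ (S k - A k) *ᵥ x| ≤ e k * (x ⬝ᵥ x)) →
      vnorm (u k - ustar k) ≤ 2 / T k * e k ∧ (S (k + 1)).IsSymm ∧
      ∀ x, |x ⬝ᵥ (S (k + 1) - A (k + 1)) *ᵥ x| ≤ e (k + 1) * (x ⬝ᵥ x) := by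
    intro k hk hs hq
    have hkd : k < d := by omega
    rw [hesucc k]
    exact deflation_step (A k) (S k) (S (k + 1)) (A (k + 1)) (idealA_symm _ _ _) hs
      (ustar k) (u k) (v k) (δ k) (lamstar k) (T k) (e k) (lam k) (hd k hkd)
      (hone _ (huunit k hk)) (hone _ (hvunit k hk)) (hvdef k hk) (hAus k hkd) (hAgap k hkd)
      (hAnn k) (hAle k hkd) hq (hTpos k hkd).1 (hTpos k hkd).2 (he0 k hk) (heT k hk)
      (hueig k hk) (husign k hk) (hutop k hk) (idealA_succ _ _ k hkd) (hSrec k)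
  have hind : ∀ k, k < K → (S k).IsSymm ∧
      ∀ x, |x ⬝ᵥ (S k - A k) *ᵥ x| ≤ e k * (x ⬝ᵥ x) := by
    intro k
    induction k with
    | zero =>
      intro hk
      refine ⟨hS0 ▸ hsym, fun x => ?_⟩
      rw [sub_mulVec, dotProduct_sub, hS0, hA0 x]
      simp [he]
    | succ k ih =>
      intro hk
      have h := ih (by omega)
      exact (hstep k (by omega) h.1 h.2).2
  intro k hk
  have hkd : k < d := by omega
  have h := (hstep k hk (hind k hk).1 (hind k hk).2).1
  have hlk := hpos k hkd
  have hTk := (hTpos k hkd).1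
  have hfin : 5 * ∑ k' ∈ Finset.range (k + 1), (lamstar k' / lamstar k) * vnorm (δ k') *
            ∏ j ∈ Finset.Ico (k' + 1) (k + 1), r j = e (k + 1) / lamstar k := by
    simp only [he]
    rw [mul_div_assoc, Finset.sum_div]
    congr 1
    refine Finset.sum_congr rfl fun i _ => ?_
    ring
  rw [hfin, hesucc k]
  have h1 : v k - ustar k = (u k - ustar k) + δ k := by rw [hvdef k hk]; abel
  rw [h1]
  refine (vnorm_add_le' _ _).trans ?_
  have h2 : (r k * e k + 5 * (lamstar k * vnorm (δ k))) / lamstar k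
      = 3 / lamstar k * e k + 2 / T k * e k + 5 * vnorm (δ k) := by
    simp only [hr]; field_simp
  rw [h2]
  have h3 : 0 ≤ 3 / lamstar k * e k := mul_nonneg (by positivity) (he0 k hk)
  have h4 := vnorm_nonneg' (δ k)
  linarith
end
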